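/- In the real Okubo algebra 𝒪 with idempotent e = diag(2,−1,−1), the map τ(x) = ⟨x,e⟩·e − x*e satisfies τ(x) = e*(e*x) for all x ∈ 𝒪, is an algebra automorphism of 𝒪 (τ is a linear bijection with τ(x*y) = τ(x)*τ(y) for all x,y), and has order three: τ∘τ∘τ = id while τ ≠ id. -/

import Mathlib

open Matrix Complex

noncomputable section

/-- `3 × 3` complex matrices. -/
abbrev M3 : Type := Matrix (Fin 3) (Fin 3) ℂ

/-- The real Okubo algebra: `3 × 3` traceless Hermitian complex matrices. -/
def Okubo : Set M3 := {x | x.IsHermitian ∧ x.trace = 0}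

/-- The constant `μ = (3 + i√3)/6`. -/
def okMu : ℂ := (3 + (Real.sqrt 3 : ℂ) * Complex.I) / 6

/-- The Okubo product `x*y = μ·(xy) + μ̄·(yx) − (1/3)Tr(xy)·Id`. -/
def omul (x y : M3) : M3 :=
  okMu • (x * y) + (starRingEnd ℂ) okMu • (y * x) - ((1 / 3 : ℂ) * (x * y).trace) • (1 : M3)

/-- The Okubic norm `n(x) = (1/6)Tr(x²)` (real-valued on Hermitian matrices). -/
def onorm (x : M3) : ℝ := (1 / 6) * ((x * x).trace).re

/-- The polar form `⟨x,y⟩ = n(x+y) − n(x) − n(y)` of the Okubic norm. -/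
def opolar (x y : M3) : ℝ := onorm (x + y) - onorm x - onorm y


/-- The idempotent `e = diag(2, −1, −1)` of the real Okubo algebra. -/
def eOk : M3 := Matrix.diagonal ![2, -1, -1]

/-- The map `τ(x) = ⟨x,e⟩ • e − x*e`. -/
def tauOk (x : M3) : M3 := opolar x eOk • eOk - omul x eOk

/-- primitive cube root of unity -/
def okW : ℂ := (-1 + (Real.sqrt 3 : ℂ) * Complex.I) / 2

/-- the diagonal unitary implementing tau -/
def okD : M3 := Matrix.diagonal ![okW, 1, 1]

lemma ok_sq : ((Real.sqrt 3 : ℝ) : ℂ) * ((Real.sqrt 3 : ℝ) : ℂ) = 3 := by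
  rw [← Complex.ofReal_mul, Real.mul_self_sqrt (by norm_num)]; norm_num

lemma ok_sqI : (((Real.sqrt 3 : ℝ) : ℂ) * Complex.I) ^ 2 = -3 := by
  linear_combination -ok_sq + (Real.sqrt 3 : ℂ)^2 * Complex.I_sq

lemma okMu_conj : (starRingEnd ℂ) okMu = (3 - (Real.sqrt 3 : ℂ) * Complex.I) / 6 := by
  simp [okMu, sub_eq_add_neg, map_ofNat]

lemma okW_conj : star okW = (-1 - (Real.sqrt 3 : ℂ) * Complex.I) / 2 := by
  change (starRingEnd ℂ) okW = _
  simp [okW, sub_eq_add_neg, map_ofNat]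

lemma okW_star_mul : star okW * okW = 1 := by
  rw [okW_conj, okW]
  linear_combination (1/4 : ℂ) * ok_sq - (1/4 : ℂ) * (Real.sqrt 3 : ℂ)^2 * Complex.I_sq

lemma okW_cube : okW * (okW * okW) = 1 := by
  have h : okW * okW = star okW := by
    rw [okW_conj, okW]
    linear_combination (-1/4 : ℂ) * ok_sq + (1/4 : ℂ) * (Real.sqrt 3 : ℂ)^2 * Complex.I_sq
  rw [h, mul_comm, okW_star_mul]

lemma okD_star : okDᴴ = Matrix.diagonal ![star okW, 1, 1] := by
  rw [okD, Matrix.diagonal_conjTranspose]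
  congr 1; ext i; fin_cases i <;> simp

lemma okD_star_mul : okDᴴ * okD = 1 := by
  rw [okD_star, okD, Matrix.diagonal_mul_diagonal, ← Matrix.diagonal_one]
  congr 1; ext i; fin_cases i
  · exact okW_star_mul
  · simp
  · simp

lemma okD_mul_star : okD * okDᴴ = 1 := mul_eq_one_comm.mp okD_star_mul

lemma okD_cube : okD * (okD * okD) = 1 := by
  rw [okD, Matrix.diagonal_mul_diagonal, Matrix.diagonal_mul_diagonal, ← Matrix.diagonal_one]
  congr 1; ext i; fin_cases i <;> simp [okW_cube]

lemma polar_e (x : M3) (hx : x ∈ Okubo) : ((opolar x eOk : ℝ) : ℂ) = x 0 0 := by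
  obtain ⟨h, ht⟩ := hx
  have h0 := h.apply 0 0
  have him : (x 0 0).im = 0 := Complex.conj_eq_iff_im.mp h0
  have ht' := congrArg Complex.re ht
  simp [Matrix.trace, Fin.sum_univ_three] at ht'
  apply Complex.ext
  · simp [opolar, onorm, eOk, Matrix.trace, Fin.sum_univ_three, Matrix.mul_apply, Matrix.diagonal]
    linarith
  · simp [him]

lemma tau_eq (x : M3) (hx : x ∈ Okubo) : tauOk x = okD * x * okDᴴ := by
  have hp := polar_e x hx
  have ht : x 2 2 = - x 0 0 - x 1 1 := by
    have := hx.2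
    simp [Matrix.trace, Fin.sum_univ_three] at this
    linear_combination this
  rw [okD_star, okD]
  ext i j
  simp only [tauOk, omul, Matrix.sub_apply, Matrix.add_apply, Matrix.smul_apply, Complex.real_smul, hp, okMu_conj]
  fin_cases i <;> fin_cases j <;>
    simp [-star_def, eOk, Matrix.trace, Fin.sum_univ_three, Matrix.mul_apply, Matrix.diagonal, ht,
      okW_conj] <;> simp only [okMu, okW] <;>
    first
    | ring1
    | linear_combination (x 0 0/4) * ok_sqI
    | linear_combination (x 0 1/4) * ok_sqI
    | linear_combination (x 0 2/4) * ok_sqI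
    | linear_combination (x 1 0/4) * ok_sqI
    | linear_combination (x 2 0/4) * ok_sqI

lemma ee_eq (x : M3) (hx : x ∈ Okubo) : omul eOk (omul eOk x) = okD * x * okDᴴ := by
  have ht : x 2 2 = - x 0 0 - x 1 1 := by
    have := hx.2
    simp [Matrix.trace, Fin.sum_univ_three] at this
    linear_combination this
  rw [okD_star, okD]
  ext i j
  simp only [omul, Matrix.sub_apply, Matrix.add_apply, Matrix.smul_apply, okMu_conj]
  fin_cases i <;> fin_cases j <;>
    simp [-star_def, eOk, Matrix.trace, Fin.sum_univ_three, Matrix.mul_apply, Matrix.diagonal, ht,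
      okW_conj] <;> simp only [okMu, okW] <;>
    first
    | ring1
    | linear_combination (x 0 0/4) * ok_sqI
    | linear_combination (x 0 1/4) * ok_sqI
    | linear_combination (x 0 2/4) * ok_sqI
    | linear_combination (x 1 0/4) * ok_sqI
    | linear_combination (x 2 0/4) * ok_sqI

lemma conj_mem (x : M3) (hx : x ∈ Okubo) : okD * x * okDᴴ ∈ Okubo := by
  refine ⟨Matrix.isHermitian_mul_mul_conjTranspose _ hx.1, ?_⟩
  rw [Matrix.trace_mul_comm, ← Matrix.mul_assoc, okD_star_mul, Matrix.one_mul]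
  exact hx.2

lemma omul_mem (x y : M3) (hx : x ∈ Okubo) (hy : y ∈ Okubo) : omul x y ∈ Okubo := by
  have htr : star (x * y).trace = (x * y).trace := by
    rw [← Matrix.trace_conjTranspose, Matrix.conjTranspose_mul, hx.1.eq, hy.1.eq,
      Matrix.trace_mul_comm]
  refine ⟨?_, ?_⟩
  · have hs : star ((starRingEnd ℂ) okMu) = okMu := star_star _
    have h3 : star (1 / 3 : ℂ) = 1 / 3 := by simp
    rw [Matrix.IsHermitian, omul, Matrix.conjTranspose_sub, Matrix.conjTranspose_add,
      Matrix.conjTranspose_smul, Matrix.conjTranspose_smul, Matrix.conjTranspose_smul,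
      Matrix.conjTranspose_mul, Matrix.conjTranspose_mul, Matrix.conjTranspose_one,
      hx.1.eq, hy.1.eq, hs, star_mul', htr, h3, add_comm]
    rfl
  · rw [omul, Matrix.trace_sub, Matrix.trace_add, Matrix.trace_smul, Matrix.trace_smul,
      Matrix.trace_smul, Matrix.trace_mul_comm y x, okMu_conj, okMu]
    simp
    ring

lemma okconj_mul (x y : M3) : (okD * x * okDᴴ) * (okD * y * okDᴴ) = okD * (x * y) * okDᴴ := by
  calc _ = okD * x * (okDᴴ * okD) * y * okDᴴ := by simp only [Matrix.mul_assoc]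
    _ = _ := by rw [okD_star_mul, Matrix.mul_one]; simp only [Matrix.mul_assoc]

lemma conj_omul (x y : M3) :
    okD * (omul x y) * okDᴴ = omul (okD * x * okDᴴ) (okD * y * okDᴴ) := by
  have ht : (okD * (x * y) * okDᴴ).trace = (x * y).trace := by
    rw [Matrix.trace_mul_comm, ← Matrix.mul_assoc, okD_star_mul, Matrix.one_mul]
  rw [omul, omul, okconj_mul, okconj_mul, ht]
  simp only [Matrix.mul_sub, Matrix.mul_add, Matrix.sub_mul, Matrix.add_mul, Matrix.mul_smul,
    Matrix.smul_mul, Matrix.mul_one, okD_mul_star]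

lemma tau_cube (x : M3) (hx : x ∈ Okubo) : tauOk (tauOk (tauOk x)) = x := by
  have h1 := conj_mem x hx
  have h2 := conj_mem _ h1
  rw [tau_eq x hx, tau_eq _ h1, tau_eq _ h2]
  calc _ = (okD * (okD * okD)) * x * (okD * (okD * okD))ᴴ := by
        simp only [Matrix.conjTranspose_mul, Matrix.mul_assoc]
    _ = x := by simp [okD_cube]

lemma tau_mem (x : M3) (hx : x ∈ Okubo) : tauOk x ∈ Okubo := by
  rw [tau_eq x hx]; exact conj_mem x hx

lemma add_mem_ok (x y : M3) (hx : x ∈ Okubo) (hy : y ∈ Okubo) : x + y ∈ Okubo :=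
  ⟨hx.1.add hy.1, by rw [Matrix.trace_add, hx.2, hy.2, add_zero]⟩

lemma smul_mem_ok (c : ℝ) (x : M3) (hx : x ∈ Okubo) : c • x ∈ Okubo := by
  refine ⟨?_, by rw [Matrix.trace_smul, hx.2, smul_zero]⟩
  rw [Matrix.IsHermitian, Matrix.conjTranspose_smul, hx.1.eq, star_trivial]

/-- With the idempotent `e = diag(2,−1,−1)`, the map
`τ(x) = ⟨x,e⟩ • e − x*e` satisfies `τ(x) = e*(e*x)`, is an algebra automorphism
of `𝒪` (an ℝ-linear bijection of `𝒪` respecting the Okubo product), and has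
order three: `τ∘τ∘τ = id` while `τ ≠ id`. -/
theorem okubo_paper_stmt9 :
    (∀ x ∈ Okubo, tauOk x = omul eOk (omul eOk x)) ∧
    (∀ x ∈ Okubo, ∀ y ∈ Okubo, tauOk (x + y) = tauOk x + tauOk y) ∧
    (∀ (c : ℝ), ∀ x ∈ Okubo, tauOk (c • x) = c • tauOk x) ∧
    Set.BijOn tauOk Okubo Okubo ∧
    (∀ x ∈ Okubo, ∀ y ∈ Okubo, tauOk (omul x y) = omul (tauOk x) (tauOk y)) ∧
    (∀ x ∈ Okubo, tauOk (tauOk (tauOk x)) = x) ∧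
    (∃ x ∈ Okubo, tauOk x ≠ x) := by
  refine ⟨fun x hx => by rw [tau_eq x hx, ee_eq x hx], fun x hx y hy => ?_, fun c x hx => ?_,
    ⟨fun x hx => tau_mem x hx, fun x hx y hy h => ?_, fun x hx => ?_⟩, fun x hx y hy => ?_,
    tau_cube, ?_⟩
  · rw [tau_eq _ (add_mem_ok x y hx hy), tau_eq x hx, tau_eq y hy, Matrix.mul_add, Matrix.add_mul]
  · rw [tau_eq _ (smul_mem_ok c x hx), tau_eq x hx, Matrix.mul_smul, Matrix.smul_mul]
  · rw [← tau_cube x hx, ← tau_cube y hy, h]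
  · exact ⟨tauOk (tauOk x), tau_mem _ (tau_mem x hx), tau_cube x hx⟩
  · rw [tau_eq _ (omul_mem x y hx hy), tau_eq x hx, tau_eq y hy, conj_omul]
  · have hm : (!![0, 1, 0; 1, 0, 0; 0, 0, 0] : M3) ∈ Okubo := by
      refine ⟨?_, by simp [Matrix.trace, Fin.sum_univ_three]⟩
      ext i j
      fin_cases i <;> fin_cases j <;> simp
    refine ⟨_, hm, fun h => ?_⟩
    rw [tau_eq _ hm, okD_star, okD] at h
    have h01 := congrFun (congrFun h 0) 1
    simp [Matrix.diagonal_mul, Matrix.mul_diagonal] at h01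
    have := congrArg Complex.re h01
    simp [okW] at this
    norm_num at this

end
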